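/- Let n ≥ 1, σ ≥ 1, s ≥ 0 with 2s < n < 2σ + 2s, and let δ₀ ∈ (0, (π/4)^{1/σ}]. Then for all t ≥ 1, ∫_{|ξ| ≤ δ₀ t^{−1/σ}} |sin(|ξ|^σ t)|² |ξ|^{−2σ−2s} dξ ≥ (ω_n/2) · δ₀^{n−2s}/(n−2s) · t^{2−(n−2s)/σ}, where ω_n is the surface area of the unit sphere in ℝⁿ. -/

import Mathlib

open Real MeasureTheory

lemma half_sq_le_sin_sq {x : ℝ} (hx : 0 ≤ x) (hx' : x ≤ π / 4) : x ^ 2 / 2 ≤ sin x ^ 2 := by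
  rcases hx.eq_or_lt with rfl | hpos
  · simp
  have h := sin_gt_sub_cube hpos
  have hle : 3 / 4 * x ≤ sin x := by
    nlinarith [pow_le_one₀ hx (by linarith [pi_lt_four] : x ≤ 1) (n := 2)]
  nlinarith

/-- Lower bound for the radial part of the small-frequency wave kernel. -/
lemma radial_small_frequency_lower_bound {n : ℕ} (hn : 1 ≤ n) {σ s t R : ℝ} (hσ : 0 < σ)
    (hs : 2 * s < n) (ht : 0 ≤ t) (hR : 0 ≤ R) (hRt : R ^ σ * t ≤ π / 4) :
    t ^ 2 / 2 * (R ^ ((n : ℝ) - 2 * s) / ((n : ℝ) - 2 * s)) ≤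
      ∫ r in Set.Ioc 0 R, r ^ (n - 1) * (|sin (r ^ σ * t)| ^ 2 * r ^ (-2 * σ - 2 * s)) := by
  have hexp : -1 < (n : ℝ) - 1 - 2 * s := by linarith
  have hint : IntegrableOn (fun r : ℝ => r ^ ((n : ℝ) - 1 - 2 * s)) (Set.Ioc 0 R) :=
    (intervalIntegrable_iff_integrableOn_Ioc_of_le hR).1
      (intervalIntegral.intervalIntegrable_rpow' hexp)
  have hpow {r : ℝ} (hr : 0 < r) :
      r ^ (n - 1) * ((r ^ σ * t) ^ 2 * r ^ (-2 * σ - 2 * s)) =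
        t ^ 2 * r ^ ((n : ℝ) - 1 - 2 * s) := by
    have h : r ^ ((n : ℝ) - 1 - 2 * s) =
        r ^ (n - 1) * ((r ^ σ) ^ 2 * r ^ (-2 * σ - 2 * s)) := by
      rw [← rpow_natCast r (n - 1), ← rpow_natCast (r ^ σ) 2, ← rpow_mul hr.le,
        ← rpow_add hr, ← rpow_add hr, Nat.cast_sub hn]
      congr 1
      push_cast
      ring
    rw [h]
    ring
  have hval : ∫ r in Set.Ioc 0 R, t ^ 2 / 2 * r ^ ((n : ℝ) - 1 - 2 * s) =
      t ^ 2 / 2 * (R ^ ((n : ℝ) - 2 * s) / ((n : ℝ) - 2 * s)) := by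
    rw [integral_const_mul, ← intervalIntegral.integral_of_le hR, integral_rpow (Or.inl hexp),
      show (n : ℝ) - 1 - 2 * s + 1 = n - 2 * s by ring, zero_rpow (by linarith), sub_zero]
  rw [← hval]
  refine setIntegral_mono_on (hint.const_mul _) ?_ measurableSet_Ioc fun r hr => ?_
  · refine (hint.const_mul (t ^ 2)).mono' (by fun_prop) ?_
    filter_upwards [ae_restrict_mem measurableSet_Ioc] with r hr
    have hr0 : 0 < r := hr.1
    rw [← hpow hr0, norm_of_nonneg (by positivity)]
    have : |sin (r ^ σ * t)| ≤ r ^ σ * t :=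
      abs_sin_le_abs.trans_eq (abs_of_nonneg (by positivity))
    gcongr
  · have hr0 : 0 < r := hr.1
    have hx : r ^ σ * t ≤ π / 4 := le_trans (by gcongr; exact hr.2) hRt
    have h := half_sq_le_sin_sq (by positivity) hx
    calc t ^ 2 / 2 * r ^ ((n : ℝ) - 1 - 2 * s)
        = r ^ (n - 1) * ((r ^ σ * t) ^ 2 / 2 * r ^ (-2 * σ - 2 * s)) := by
          linear_combination -(1 / 2) * hpow hr0
      _ ≤ _ := by
          rw [sq_abs]
          gcongr

/-- Polar coordinates for the integral of a radial function over a closed ball. -/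
lemma setIntegral_fun_norm_le {n : ℕ} (hn : 1 ≤ n) (f : ℝ → ℝ) (R : ℝ) :
    ∫ ξ in {ξ : EuclideanSpace ℝ (Fin n) | ‖ξ‖ ≤ R}, f ‖ξ‖ =
      n * (volume (Metric.ball (0 : EuclideanSpace ℝ (Fin n)) 1)).toReal *
        ∫ r in Set.Ioc 0 R, r ^ (n - 1) * f r := by
  have : Nonempty (Fin n) := ⟨⟨0, hn⟩⟩
  have hmeas : MeasurableSet {ξ : EuclideanSpace ℝ (Fin n) | ‖ξ‖ ≤ R} :=
    measurableSet_le measurable_norm measurable_const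
  have hind : {ξ : EuclideanSpace ℝ (Fin n) | ‖ξ‖ ≤ R}.indicator (fun ξ => f ‖ξ‖) =
      fun ξ => (Set.Iic R).indicator f ‖ξ‖ := rfl
  have hind' : (fun r : ℝ => r ^ (n - 1) • (Set.Iic R).indicator f r) =
      (Set.Iic R).indicator fun r => r ^ (n - 1) * f r := by
    ext r
    simp [Set.indicator_apply]
  rw [← integral_indicator hmeas, hind, integral_fun_norm_addHaar, finrank_euclideanSpace_fin,
    hind', setIntegral_indicator measurableSet_Iic, Set.Ioi_inter_Iic, nsmul_eq_mul, smul_eq_mul,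
    measureReal_def, mul_assoc]

theorem small_frequency_growth_lower_bound
    (n : ℕ) (hn : 1 ≤ n) (σ s δ₀ : ℝ) (hσ : 1 ≤ σ) (hs : 0 ≤ s)
    (h₁ : 2 * s < n) (h₂ : (n : ℝ) < 2 * σ + 2 * s)
    (hδ₀ : 0 < δ₀) (hδ₀' : δ₀ ≤ (π / 4) ^ (1 / σ))
    (ωn : ℝ) (hω : ωn = n * (volume (Metric.ball (0 : EuclideanSpace ℝ (Fin n)) 1)).toReal) :
    ∀ t : ℝ, 1 ≤ t →
      (∫ ξ in {ξ : EuclideanSpace ℝ (Fin n) | ‖ξ‖ ≤ δ₀ * t ^ (-1 / σ)},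
          |Real.sin (‖ξ‖ ^ σ * t)| ^ 2 * ‖ξ‖ ^ (-2 * σ - 2 * s)) ≥
        (ωn / 2) * (δ₀ ^ ((n : ℝ) - 2 * s) / ((n : ℝ) - 2 * s)) *
          t ^ (2 - ((n : ℝ) - 2 * s) / σ) := by
  intro t ht
  have ht0 : 0 < t := by linarith
  have hσ0 : 0 < σ := by linarith
  have hscale : (δ₀ * t ^ (-1 / σ)) ^ σ * t ≤ π / 4 := by
    rw [mul_rpow hδ₀.le (by positivity), ← rpow_mul ht0.le, div_mul_cancel₀ _ hσ0.ne',
      rpow_neg_one, mul_assoc, inv_mul_cancel₀ ht0.ne', mul_one]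
    calc δ₀ ^ σ ≤ ((π / 4) ^ (1 / σ)) ^ σ := by gcongr
      _ = π / 4 := by
        rw [← rpow_mul (by positivity), one_div_mul_cancel hσ0.ne', rpow_one]
  have hpow : t ^ (2 - ((n : ℝ) - 2 * s) / σ) =
      t ^ 2 * (t ^ (-1 / σ)) ^ ((n : ℝ) - 2 * s) := by
    rw [← rpow_mul ht0.le, ← rpow_natCast t 2, ← rpow_add ht0]
    congr 1
    push_cast
    ring
  have hω0 : 0 ≤ ωn := hω ▸ by positivity
  rw [setIntegral_fun_norm_le hn
    (fun r => |Real.sin (r ^ σ * t)| ^ 2 * r ^ (-2 * σ - 2 * s)), ← hω, ge_iff_le]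
  calc _ = ωn * (t ^ 2 / 2 *
        ((δ₀ * t ^ (-1 / σ)) ^ ((n : ℝ) - 2 * s) / ((n : ℝ) - 2 * s))) := by
        rw [hpow, mul_rpow hδ₀.le (by positivity)]
        ring
    _ ≤ _ := by
        gcongr
        exact radial_small_frequency_lower_bound hn hσ0 h₁ ht0.le (by positivity) hscale
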